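/- There exist a constant c > 0 and an n_0 such that for all n ≥ n_0, C_3(n, SP_4^1) ≥ c · n^{1/8}. -/

import Mathlib

open Finset

/-- A hypergraph on a finite set of natural-number vertices. -/
structure HGraph where
  verts : Finset ℕ
  edges : Finset (Finset ℕ)

/-- `H` is an `r`-uniform hypergraph. -/
def HGraph.IsUniform (H : HGraph) (r : ℕ) : Prop :=
  ∀ e ∈ H.edges, e ⊆ H.verts ∧ e.card = r

/-- `φ` determines a copy of `H` in the complete hypergraph on vertex set `range n`. -/
def IsCopy (n : ℕ) (H : HGraph) (φ : ℕ → ℕ) : Prop :=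
  Set.InjOn φ ↑H.verts ∧ ∀ v ∈ H.verts, φ v ∈ Finset.range n

/-- The family of edge-colourings `f v` with `k` colours is an `(n,r,H)`-local colouring:
for every copy of `H` there is a vertex of the copy whose colouring is rainbow on it. -/
def IsLocalColoring (n k : ℕ) (H : HGraph) (f : ℕ → Finset ℕ → Fin k) : Prop :=
  ∀ φ : ℕ → ℕ, IsCopy n H φ →
    ∃ x ∈ H.verts, ∀ e₁ ∈ H.edges, ∀ e₂ ∈ H.edges,
      f (φ x) (e₁.image φ) = f (φ x) (e₂.image φ) → e₁ = e₂

/-- The local rainbow colouring number `C_r(n,H)`: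
the least number of colours admitting an `(n,r,H)`-local colouring. -/
noncomputable def localC (n : ℕ) (H : HGraph) : ℕ :=
  sInf {k | ∃ f : ℕ → Finset ℕ → Fin k, IsLocalColoring n k H f}

/-- Starting vertex of the `j`-th edge of `SP_t^1`. -/
def sp1start (j : ℕ) : ℕ := if j % 2 = 1 then 3 * (j - 1) / 2 + 1 else 3 * j / 2

/-- The special path `SP_t^1` on vertex set `{1, …, ⌈(3t+3)/2⌉}`: consecutive edges
alternately share one vertex and two vertices, beginning with an overlap of one vertex. -/
def SP1 (t : ℕ) : HGraph :=
  ⟨Finset.Icc 1 ((3 * t + 4) / 2),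
   (Finset.Icc 1 t).image fun j => {sp1start j, sp1start j + 1, sp1start j + 2}⟩

/-- Starting vertex of the `j`-th edge of `SP_t^2`. -/
def sp2start (j : ℕ) : ℕ := if j % 2 = 1 then 3 * (j - 1) / 2 + 1 else (3 * j - 2) / 2

/-- The special path `SP_t^2` on vertex set `{1, …, ⌈(3t+2)/2⌉}`: consecutive edges
alternately share two vertices and one vertex, beginning with an overlap of two vertices. -/
def SP2 (t : ℕ) : HGraph :=
  ⟨Finset.Icc 1 ((3 * t + 3) / 2),
   (Finset.Icc 1 t).image fun j => {sp2start j, sp2start j + 1, sp2start j + 2}⟩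

/-- The ordered triples of distinct elements of `S` on which `g` is constant. -/
def monoTriples {α : Type*} [DecidableEq α] (g : ℕ → α) (S : Finset ℕ) : Finset (ℕ × ℕ × ℕ) :=
  (S ×ˢ S ×ˢ S).filter fun t =>
    t.1 ≠ t.2.1 ∧ t.1 ≠ t.2.2 ∧ t.2.1 ≠ t.2.2 ∧ g t.1 = g t.2.1 ∧ g t.2.1 = g t.2.2

theorem mem_monoTriples {α : Type*} [DecidableEq α] {g : ℕ → α} {S : Finset ℕ} {a b c : ℕ} :
    (a, b, c) ∈ monoTriples g S ↔
      (a ∈ S ∧ b ∈ S ∧ c ∈ S) ∧ a ≠ b ∧ a ≠ c ∧ b ≠ c ∧ g a = g b ∧ g b = g c := by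
  simp [monoTriples]

/-- A `k`-colouring of `2 * k + j` points has at least `j` monochromatic triples. -/
theorem card_le_card_monoTriples {k : ℕ} (g : ℕ → Fin k) (S : Finset ℕ) :
    S.card ≤ 2 * k + (monoTriples g S).card := by
  induction S using Finset.strongInduction with
  | H S ih =>
    by_cases hS : S.card ≤ 2 * k
    · omega
    obtain ⟨z, -, hz⟩ := Finset.exists_lt_card_fiber_of_mul_lt_card_of_maps_to
      (s := S) (t := Finset.univ) (f := g) (n := 2) (fun _ _ => Finset.mem_univ _)
      (by simp; omega)
    obtain ⟨a, ha, b, hb, c, hc, hab, hac, hbc⟩ := Finset.two_lt_card.1 hz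
    rw [Finset.mem_filter] at ha hb hc
    have hlt : (monoTriples g (S.erase a)).card < (monoTriples g S).card := by
      apply Finset.card_lt_card
      rw [Finset.ssubset_iff_of_subset]
      · exact ⟨(a, b, c), mem_monoTriples.2
          ⟨⟨ha.1, hb.1, hc.1⟩, hab, hac, hbc, ha.2.trans hb.2.symm, hb.2.trans hc.2.symm⟩,
          fun h => by simp [mem_monoTriples] at h⟩
      · rintro ⟨p, q, r⟩ h
        rw [mem_monoTriples] at h ⊢
        exact ⟨⟨Finset.mem_of_mem_erase h.1.1, Finset.mem_of_mem_erase h.1.2.1,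
          Finset.mem_of_mem_erase h.1.2.2⟩, h.2⟩
    have h1 := ih _ (Finset.erase_ssubset ha.1)
    rw [Finset.card_erase_of_mem ha.1] at h1
    omega

theorem SP1_four :
    SP1 4 = ⟨Finset.Icc 1 8, {{1, 2, 3}, {3, 4, 5}, {4, 5, 6}, {6, 7, 8}}⟩ := by
  simp only [SP1, HGraph.mk.injEq]
  decide

/-- Among sufficiently many vertices `x` there are two, together with three of the pairs
`{2 * i, 2 * i + 1}`, such that each of the two sees the three pairs in one colour, and each vertex
of the three pairs gives the same colour to the middle pair joined with either of the two. -/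
theorem exists_collision {n k : ℕ} (f : ℕ → Finset ℕ → Fin k) (hn : 33 * k ^ 8 < n) :
    ∃ x y i j l : ℕ, x ∈ Finset.Ico (6 * k) n ∧ y ∈ Finset.Ico (6 * k) n ∧ x ≠ y ∧
      (i, j, l) ∈ monoTriples (fun a => f x {x, 2 * a, 2 * a + 1}) (Finset.range (3 * k)) ∧
      (i, j, l) ∈ monoTriples (fun a => f y {y, 2 * a, 2 * a + 1}) (Finset.range (3 * k)) ∧
      ∀ a ∈ ({i, j, l} : Finset ℕ), ∀ v ∈ ({2 * a, 2 * a + 1} : Finset ℕ),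
        f v {x, 2 * j, 2 * j + 1} = f v {y, 2 * j, 2 * j + 1} := by
  have hk : 0 < k := (f 0 ∅).pos
  let M : ℕ → Finset (ℕ × ℕ × ℕ) := fun x =>
    monoTriples (fun a => f x {x, 2 * a, 2 * a + 1}) (Finset.range (3 * k))
  let D : Finset (Σ _ : ℕ, ℕ × ℕ × ℕ) := (Finset.Ico (6 * k) n).sigma M
  let T : Finset (ℕ × ℕ × ℕ) :=
    Finset.range (3 * k) ×ˢ Finset.range (3 * k) ×ˢ Finset.range (3 * k)
  let F : (Σ _ : ℕ, ℕ × ℕ × ℕ) → (ℕ × ℕ × ℕ) × (Fin 6 → Fin k) := fun p =>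
    (p.2, fun a => f (![2 * p.2.1, 2 * p.2.1 + 1, 2 * p.2.2.1, 2 * p.2.2.1 + 1, 2 * p.2.2.2,
      2 * p.2.2.2 + 1] a) {p.1, 2 * p.2.2.1, 2 * p.2.2.1 + 1})
  have hD : (n - 6 * k) * k ≤ D.card := by
    rw [Finset.card_sigma, ← Nat.card_Ico, ← smul_eq_mul]
    refine Finset.card_nsmul_le_sum _ _ _ fun x _ => ?_
    have := card_le_card_monoTriples (fun a => f x {x, 2 * a, 2 * a + 1}) (Finset.range (3 * k))
    rw [Finset.card_range] at this
    change k ≤ (monoTriples _ _).card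
    omega
  have hT : (T ×ˢ (Finset.univ : Finset (Fin 6 → Fin k))).card = 27 * k ^ 8 * k := by
    simp only [T, Finset.card_product, Finset.card_range, Finset.card_univ, Fintype.card_fun,
      Fintype.card_fin]
    ring
  have hlt : (T ×ˢ (Finset.univ : Finset (Fin 6 → Fin k))).card < D.card := by
    rw [hT]
    refine lt_of_lt_of_le (Nat.mul_lt_mul_of_pos_right ?_ hk) hD
    have : k ≤ k ^ 8 := Nat.le_self_pow (by norm_num) k
    omega
  have hmaps : ∀ p ∈ D, F p ∈ T ×ˢ (Finset.univ : Finset (Fin 6 → Fin k)) := by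
    rintro ⟨x, t⟩ hp
    exact Finset.mem_product.2
      ⟨Finset.filter_subset _ _ (Finset.mem_sigma.1 hp).2, Finset.mem_univ _⟩
  obtain ⟨⟨x, i, j, l⟩, hx, ⟨y, t⟩, hy, hne, heq⟩ :=
    Finset.exists_ne_map_eq_of_card_lt_of_maps_to hlt hmaps
  obtain ⟨rfl, hc⟩ := Prod.ext_iff.1 heq
  rw [Finset.mem_sigma] at hx hy
  refine ⟨x, y, i, j, l, hx.1, hy.1, fun h => hne (by subst h; rfl), hx.2, hy.2, ?_⟩
  have h0 := congrFun hc 0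
  have h1 := congrFun hc 1
  have h2 := congrFun hc 2
  have h3 := congrFun hc 3
  have h4 := congrFun hc 4
  have h5 := congrFun hc 5
  simp only [Finset.mem_insert, Finset.mem_singleton]
  rintro a (rfl | rfl | rfl) v (rfl | rfl)
  exacts [h0, h1, h2, h3, h4, h5]

theorem le_of_isLocalColoring_SP1_four {n k : ℕ} {f : ℕ → Finset ℕ → Fin k}
    (hf : IsLocalColoring n k (SP1 4) f) : n ≤ 33 * k ^ 8 := by
  by_contra! hn
  obtain ⟨x, y, i, j, l, hx, hy, hxy, hMx, hMy, hc⟩ := exists_collision f hn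
  simp only [mem_monoTriples, Finset.mem_range, Finset.mem_Ico] at hMx hMy hx hy
  obtain ⟨⟨hi, hj, hl⟩, hij, hil, hjl, hxij, -⟩ := hMx
  obtain ⟨-, -, -, -, -, hyjl⟩ := hMy
  let φ : ℕ → ℕ := fun v =>
    if v = 1 then 2 * i else if v = 2 then 2 * i + 1 else if v = 3 then x else
    if v = 4 then 2 * j else if v = 5 then 2 * j + 1 else if v = 6 then y else
    if v = 7 then 2 * l else 2 * l + 1
  have hA : ({1, 2, 3} : Finset ℕ).image φ = {x, 2 * i, 2 * i + 1} := by
    ext; simp [φ]; tauto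
  have hB : ({3, 4, 5} : Finset ℕ).image φ = {x, 2 * j, 2 * j + 1} := by
    ext; simp [φ]
  have hC : ({4, 5, 6} : Finset ℕ).image φ = {y, 2 * j, 2 * j + 1} := by
    ext; simp [φ]; tauto
  have hD : ({6, 7, 8} : Finset ℕ).image φ = {y, 2 * l, 2 * l + 1} := by
    ext; simp [φ]
  have hcopy : IsCopy n (SP1 4) φ := by
    rw [SP1_four]
    constructor
    · intro u hu v hv huv
      simp only [Finset.coe_Icc, Set.mem_Icc] at hu hv
      obtain ⟨hu1, hu8⟩ := hu
      obtain ⟨hv1, hv8⟩ := hv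
      interval_cases u <;> interval_cases v <;> simp [φ] at huv ⊢ <;> omega
    · intro v hv
      rw [Finset.mem_Icc] at hv
      rw [Finset.mem_range]
      obtain ⟨hv1, hv8⟩ := hv
      interval_cases v <;> simp [φ] <;> omega
  obtain ⟨v, hv, hinj⟩ := hf φ hcopy
  rw [SP1_four] at hv hinj
  have hAB : f (φ v) {x, 2 * i, 2 * i + 1} ≠ f (φ v) {x, 2 * j, 2 * j + 1} := fun h =>
    absurd (hinj {1, 2, 3} (by simp) {3, 4, 5} (by simp) (by rwa [hA, hB])) (by decide)
  have hBC : f (φ v) {x, 2 * j, 2 * j + 1} ≠ f (φ v) {y, 2 * j, 2 * j + 1} := fun h =>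
    absurd (hinj {3, 4, 5} (by simp) {4, 5, 6} (by simp) (by rwa [hB, hC])) (by decide)
  have hCD : f (φ v) {y, 2 * j, 2 * j + 1} ≠ f (φ v) {y, 2 * l, 2 * l + 1} := fun h =>
    absurd (hinj {4, 5, 6} (by simp) {6, 7, 8} (by simp) (by rwa [hC, hD])) (by decide)
  obtain ⟨hv1, hv8⟩ := Finset.mem_Icc.1 hv
  interval_cases v
  · exact hBC (hc i (by simp) _ (by simp [φ]))
  · exact hBC (hc i (by simp) _ (by simp [φ]))
  · exact hAB hxij
  · exact hBC (hc j (by simp) _ (by simp [φ]))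
  · exact hBC (hc j (by simp) _ (by simp [φ]))
  · exact hCD hyjl
  · exact hBC (hc l (by simp) _ (by simp [φ]))
  · exact hBC (hc l (by simp) _ (by simp [φ]))

/-- Giving distinct colours to all subsets of `range n` is a local colouring. -/
theorem exists_isLocalColoring {n : ℕ} {H : HGraph} (hne : H.verts.Nonempty)
    (hH : ∀ e ∈ H.edges, e ⊆ H.verts) :
    ∃ k, ∃ f : ℕ → Finset ℕ → Fin k, IsLocalColoring n k H f := by
  let N := (Finset.range n).powerset.sup Encodable.encode
  have hlt : ∀ e ∈ (Finset.range n).powerset, Encodable.encode e < N + 1 := fun e he =>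
    Nat.lt_succ_of_le (Finset.le_sup (f := Encodable.encode) he)
  refine ⟨N + 1, fun _ e => Fin.ofNat (N + 1) (Encodable.encode e), fun φ hφ => ?_⟩
  obtain ⟨x, hx⟩ := hne
  refine ⟨x, hx, fun e₁ h₁ e₂ h₂ h => ?_⟩
  have himage : ∀ e ∈ H.edges, e.image φ ∈ (Finset.range n).powerset := fun e he =>
    Finset.mem_powerset.2 (Finset.image_subset_iff.2 fun v hv => hφ.2 v (hH e he hv))
  have h' := congrArg Fin.val h
  simp only [Fin.val_ofNat, Nat.mod_eq_of_lt (hlt _ (himage _ h₁)),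
    Nat.mod_eq_of_lt (hlt _ (himage _ h₂))] at h'
  have himg := congrArg (fun s : Finset ℕ => (s : Set ℕ)) (Encodable.encode_injective h')
  simp only [Finset.coe_image] at himg
  exact_mod_cast (hφ.1.image_eq_image_iff (Finset.coe_subset.2 (hH _ h₁))
    (Finset.coe_subset.2 (hH _ h₂))).1 himg

theorem stmt_10 :
    ∃ c : ℝ, 0 < c ∧ ∃ n₀ : ℕ, ∀ n : ℕ, n₀ ≤ n →
      c * (n : ℝ) ^ ((1 : ℝ) / 8) ≤ (localC n (SP1 4) : ℝ) := by
  refine ⟨1 / 2, by norm_num, 0, fun n _ => ?_⟩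
  have hne : {k | ∃ f : ℕ → Finset ℕ → Fin k, IsLocalColoring n k (SP1 4) f}.Nonempty := by
    apply exists_isLocalColoring <;> rw [SP1_four]
    · exact ⟨1, by simp⟩
    · decide
  obtain ⟨f, hf⟩ := Nat.sInf_mem hne
  have hle : n ≤ 33 * localC n (SP1 4) ^ 8 := le_of_isLocalColoring_SP1_four hf
  set k := localC n (SP1 4)
  have hle' : (n : ℝ) ≤ (2 * k : ℝ) ^ 8 := by
    have h : (n : ℝ) ≤ 33 * (k : ℝ) ^ 8 := by exact_mod_cast hle
    have : (0 : ℝ) ≤ (k : ℝ) ^ 8 := by positivity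
    rw [mul_pow]
    linarith
  have hroot : (n : ℝ) ^ ((1 : ℝ) / 8) ≤ 2 * k := by
    calc (n : ℝ) ^ ((1 : ℝ) / 8) ≤ ((2 * k : ℝ) ^ 8) ^ ((1 : ℝ) / 8) := by gcongr
      _ = 2 * k := by
        rw [← Real.rpow_natCast, ← Real.rpow_mul (by positivity)]
        norm_num
  linarith
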